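/- arXiv:1901.01055 — 2 statements merged into one kernel-verified Lean document; each statement's English description precedes it below -/
import Mathlib

section
/- For all integers d ≥ 1 and k ≥ 1, every real ε > 0, and every integer n ≥ 1, there exist n points P_1, ..., P_n in Euclidean space R^d and real numbers t_1, ..., t_k > 0 such that the number of unordered pairs {i, j} (i ≠ j) with dist(P_i, P_j) ∈ ⋃_{p=1}^{k} [t_p, t_p(1 + ε)] is at least the Turán number T(n, (d + 1)^k + 1). In other words, the upper bound T(n, (d + 1)^k + 1) cannot be reduced to T(n, (d + 1)^k + 1) − 1. -/
open scoped Classical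

/-- The Turán number `T(n, r)`: the number of edges of the Turán graph on `n`
vertices with `r - 1` parts (the maximum number of edges of a `Kᵣ`-free graph
on `n` vertices). -/
noncomputable def turanNum (n r : ℕ) : ℕ :=
  (SimpleGraph.turanGraph n (r - 1)).edgeFinset.card

/-- `ℝᵈ` contains `d + 1` points with all mutual distances equal to `√2`: the standard basis
vectors together with a suitable multiple of the all-ones vector. -/
lemma exists_regular_simplex (d : ℕ) (hd : 1 ≤ d) :
    ∃ v : Fin (d + 1) → EuclideanSpace ℝ (Fin d),
      ∀ i j, i ≠ j → dist (v i) (v j) = √2 := by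
  obtain ⟨a, ha⟩ : ∃ a : ℝ, (1 - a) ^ 2 + ((d : ℝ) - 1) * a ^ 2 = 2 := by
    have hd0 : (d : ℝ) ≠ 0 := by positivity
    refine ⟨(1 + √(1 + d)) / d, ?_⟩
    have hs : √(1 + (d : ℝ)) ^ 2 = 1 + d := Real.sq_sqrt (by positivity)
    field_simp
    linear_combination (d : ℝ) * hs
  have dist_apex (i : Fin d) : dist (WithLp.toLp 2 (fun _ : Fin d => a))
      (EuclideanSpace.single i (1 : ℝ)) = √2 := by
    rw [EuclideanSpace.dist_eq]
    congr 1
    rw [← Finset.add_sum_erase _ _ (Finset.mem_univ i),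
      Finset.sum_congr rfl (g := fun _ => a ^ 2)]
    · simp [Real.dist_eq, Nat.cast_sub hd]
      linear_combination ha
    · intro j hj
      simp [Finset.ne_of_mem_erase hj]
  refine ⟨Fin.cons (WithLp.toLp 2 fun _ => a) fun i => EuclideanSpace.single i (1 : ℝ), ?_⟩
  intro i j hij
  cases i using Fin.cases with
  | zero =>
    cases j using Fin.cases with
    | zero => exact absurd rfl hij
    | succ j => simpa using dist_apex j
  | succ i =>
    cases j using Fin.cases with
    | zero => simpa [dist_comm] using dist_apex i
    | succ j =>
      have h : i ≠ j := fun h => hij (congrArg Fin.succ h)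
      simp only [Fin.cons_succ]
      rw [EuclideanSpace.dist_eq, ← Finset.add_sum_erase _ _ (Finset.mem_univ i),
        ← Finset.add_sum_erase _ _ (Finset.mem_erase.2 ⟨h.symm, Finset.mem_univ j⟩),
        Finset.sum_eq_zero]
      · simp [h, h.symm, Real.dist_eq, one_add_one_eq_two]
      · intro l hl
        simp only [Finset.mem_erase] at hl
        simp [hl.1, hl.2.1]

/-- Nested scaled copies of an equilateral configuration: all distances between points with
different addresses of length `k` lie in one of `k` multiplicatively short intervals. -/
lemma exists_nested_configuration {E ι : Type*} [NormedAddCommGroup E] [NormedSpace ℝ E]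
    [Finite ι] {s : ℝ} (hs : 0 < s) (v : ι → E) (hv : ∀ i j, i ≠ j → dist (v i) (v j) = s)
    {ε : ℝ} (hε : 0 < ε) (k : ℕ) :
    ∃ (x : (Fin k → ι) → E) (t : Fin k → ℝ), (∀ p, 0 < t p) ∧
      ∀ a b, a ≠ b → ∃ p, dist (x a) (x b) ∈ Set.Icc (t p) (t p * (1 + ε)) := by
  induction k with
  | zero => exact ⟨fun _ => 0, fun _ => 1, fun p => p.elim0,
      fun a b h => absurd (Subsingleton.elim a b) h⟩
  | succ k ih =>
    obtain ⟨x, t, ht, hx⟩ := ih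
    obtain ⟨M, hM, hxM⟩ : ∃ M > 0, ∀ a b, dist (x a) (x b) ≤ M := by
      obtain ⟨C, hC⟩ := Metric.isBounded_iff.1 (Set.finite_range x).isBounded
      exact ⟨max C 1, by positivity, fun a b =>
        (hC (Set.mem_range_self a) (Set.mem_range_self b)).trans (le_max_left _ _)⟩
    obtain ⟨c, hc, hcs⟩ : ∃ c > 0, c * s = M + 2 * M / ε :=
      ⟨(M + 2 * M / ε) / s, by positivity, by field_simp⟩
    refine ⟨fun a => c • v (a 0) + x (Fin.tail a), Fin.cons (2 * M / ε) t, ?_, ?_⟩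
    · intro p
      cases p using Fin.cases with
      | zero => simp only [Fin.cons_zero]; positivity
      | succ p => simpa using ht p
    · intro a b hab
      by_cases h : a 0 = b 0
      · have htail : Fin.tail a ≠ Fin.tail b := fun ht => hab <| by
          rw [← Fin.cons_self_tail a, ← Fin.cons_self_tail b, h, ht]
        obtain ⟨p, hp⟩ := hx _ _ htail
        exact ⟨p.succ, by simpa [h] using hp⟩
      · refine ⟨0, ?_⟩
        have hcv : dist (c • v (a 0)) (c • v (b 0)) = M + 2 * M / ε := by
          rw [dist_smul₀, hv _ _ h, Real.norm_of_nonneg hc.le, hcs]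
        have hle := hxM (Fin.tail a) (Fin.tail b)
        have hupper := dist_add_add_le (c • v (a 0)) (x (Fin.tail a))
          (c • v (b 0)) (x (Fin.tail b))
        have hlower : dist (c • v (a 0)) (c • v (b 0)) ≤
            dist (c • v (a 0) + x (Fin.tail a)) (c • v (b 0) + x (Fin.tail b)) +
              dist (x (Fin.tail a)) (x (Fin.tail b)) := by
          simpa using dist_sub_sub_le (c • v (a 0) + x (Fin.tail a)) (x (Fin.tail a))
            (c • v (b 0) + x (Fin.tail b)) (x (Fin.tail b))
        have hmul : 2 * M / ε * (1 + ε) = 2 * M / ε + 2 * M := by field_simp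
        simp only [Fin.cons_zero, Set.mem_Icc, hmul]
        constructor <;> linarith

lemma card_edgeFinset_le_card_filter_lt {V : Type*} [Fintype V] [LinearOrder V]
    (G : SimpleGraph V) [Fintype G.edgeSet] (p : V × V → Prop) [DecidablePred p]
    (h : ∀ a b, a < b → G.Adj a b → p (a, b)) :
    G.edgeFinset.card ≤ (Finset.univ.filter fun q : V × V => q.1 < q.2 ∧ p q).card := by
  refine (Finset.card_le_card fun e he => ?_).trans
    (Finset.card_image_le (f := fun q : V × V => s(q.1, q.2)))
  induction e using Sym2.ind with
  | _ a b =>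
    rw [SimpleGraph.mem_edgeFinset, SimpleGraph.mem_edgeSet] at he
    rw [Finset.mem_image]
    rcases he.ne.lt_or_gt with hlt | hlt
    · exact ⟨(a, b), by simpa [hlt] using h a b hlt he, rfl⟩
    · exact ⟨(b, a), by simpa [hlt] using h b a hlt he.symm, Sym2.eq_swap⟩

theorem exists_points_count_pairs_in_k_multiplicative_intervals_ge_turan
    (d k : ℕ) (hd : 1 ≤ d) (hk : 1 ≤ k) (ε : ℝ) (hε : 0 < ε)
    (n : ℕ) (hn : 1 ≤ n) :
    ∃ (P : Fin n → EuclideanSpace ℝ (Fin d)) (t : Fin k → ℝ),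
      (∀ p, 0 < t p) ∧
      turanNum n ((d + 1) ^ k + 1) ≤
        (Finset.univ.filter fun q : Fin n × Fin n => q.1 < q.2 ∧
            ∃ p, dist (P q.1) (P q.2) ∈
              Set.Icc (t p) (t p * (1 + ε))).card := by
  obtain ⟨v, hv⟩ := exists_regular_simplex d hd
  obtain ⟨x, t, ht, hx⟩ := exists_nested_configuration (by positivity) v hv hε k
  have hN : 0 < (d + 1) ^ k := by positivity
  refine ⟨fun i => x (finFunctionFinEquiv.symm ⟨i % (d + 1) ^ k, Nat.mod_lt _ hN⟩), t, ht, ?_⟩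
  unfold turanNum
  refine card_edgeFinset_le_card_filter_lt _ _ fun a b _ hadj => hx _ _ fun heq => ?_
  rw [Nat.add_sub_cancel, SimpleGraph.turanGraph_adj] at hadj
  exact hadj (Fin.mk.inj_iff.1 (finFunctionFinEquiv.symm.injective heq))
end

section
/- For all integers d ≥ 1 and k ≥ 1 there exists ε_{d,k} > 0 such that for every ε with 0 < ε < ε_{d,k} the following holds: for every integer n ≥ 1, any n points P_1, ..., P_n in Euclidean space R^d, and any real numbers t_1, ..., t_k > 0, the number of unordered pairs {i, j} (i ≠ j) with dist(P_i, P_j) ∈ ⋃_{p=1}^{k} [t_p, t_p + ε·min{t_1, ..., t_k}] is at most the Turán number T(n, (d + 1)^k + 1). -/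
open scoped Classical

open Filter Topology
open scoped Pointwise

/-- The span of the separated functions `(i, j) ↦ u i * w j` with `u ∈ V ^ a`, `w ∈ V ^ b` and
`a + b = n`. -/
def separatedSpan {Y : Type*} (V : Submodule ℝ (Y → ℝ)) (n : ℕ) : Submodule ℝ (Y → Y → ℝ) :=
  Submodule.span ℝ {F | ∃ a b : ℕ, a + b = n ∧ ∃ u ∈ V ^ a, ∃ w ∈ V ^ b, F = fun i j => u i * w j}

theorem separatedSpan_mul_le {Y : Type*} (V : Submodule ℝ (Y → ℝ)) (m n : ℕ) :
    separatedSpan V m * separatedSpan V n ≤ separatedSpan V (m + n) := by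
  unfold separatedSpan
  rw [Submodule.span_mul_span]
  refine Submodule.span_mono ?_
  rintro _ ⟨_, ⟨a, b, rfl, u, hu, w, hw, rfl⟩, _, ⟨a', b', rfl, u', hu', w', hw', rfl⟩, rfl⟩
  refine ⟨a + a', b + b', by omega, u * u', ?_, w * w', ?_, ?_⟩
  · rw [pow_add]; exact Submodule.mul_mem_mul hu hu'
  · rw [pow_add]; exact Submodule.mul_mem_mul hw hw'
  · funext i j
    simp only [Pi.mul_apply]
    ring

theorem prod_mem_separatedSpan {Y ι : Type*} (V : Submodule ℝ (Y → ℝ)) (S : Finset ι)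
    (F : ι → Y → Y → ℝ) (m : ℕ) (hF : ∀ p ∈ S, F p ∈ separatedSpan V m) :
    ∏ p ∈ S, F p ∈ separatedSpan V (m * S.card) := by
  induction S using Finset.induction_on with
  | empty =>
    refine Submodule.subset_span ⟨0, 0, by simp, 1, ?_, 1, ?_, ?_⟩
    · rw [pow_zero]; exact Submodule.one_le.1 le_rfl
    · rw [pow_zero]; exact Submodule.one_le.1 le_rfl
    · funext i j; simp
  | insert p S hp ih =>
    rw [Finset.prod_insert hp, Finset.card_insert_of_notMem hp,
      show m * (S.card + 1) = m + m * S.card by ring]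
    exact separatedSpan_mul_le V _ _ (Submodule.mul_mem_mul (hF p (Finset.mem_insert_self _ _))
      (ih fun q hq => hF q (Finset.mem_insert_of_mem hq)))

theorem apply_apply_eq_zero_of_mem_separatedSpan {Y : Type*} {V : Submodule ℝ (Y → ℝ)}
    (hV : 1 ∈ V) {s : ℕ} {f : (Y → ℝ) →ₗ[ℝ] ℝ} (hf : ∀ u ∈ V ^ s, f u = 0)
    {F : Y → Y → ℝ} (hF : F ∈ separatedSpan V (2 * s)) : f (fun i => f (F i)) = 0 := by
  have hle : separatedSpan V (2 * s) ≤ LinearMap.ker (f ∘ₗ f.compLeft Y) := by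
    refine Submodule.span_le.2 ?_
    rintro _ ⟨a, b, hab, u, hu, w, hw, rfl⟩
    have h1 : f.compLeft Y (fun i j => u i * w j) = f w • u := by
      funext i
      have : (fun j => u i * w j) = u i • w := rfl
      simp [LinearMap.compLeft_apply, this, mul_comm]
    have h2 : f u * f w = 0 := by
      rcases le_or_gt a s with h | h
      · rw [hf u (pow_le_pow_right₀ (Submodule.one_le.2 hV) h hu), zero_mul]
      · rw [hf w (pow_le_pow_right₀ (Submodule.one_le.2 hV) (by omega) hw), mul_zero]
    simp [h1, mul_comm, h2]
  exact hle hF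

/-- A set with `s` nonzero distances in `ℝᵈ` has at most `(d + 1) ^ s` points. -/
theorem card_le_of_dist_mem {Y ι : Type*} [Fintype Y] {d : ℕ} (x : Y → EuclideanSpace ℝ (Fin d))
    (S : Finset ι) (τ : ι → ℝ) (hτ : ∀ p ∈ S, τ p ≠ 0)
    (h : ∀ i j, i ≠ j → ∃ p ∈ S, dist (x i) (x j) = τ p) :
    Fintype.card Y ≤ (d + 1) ^ S.card := by
  by_contra! hlt
  set B : Finset (Y → ℝ) :=
    Finset.univ.image fun o : Option (Fin d) => o.elim 1 fun l i => x i l with hB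
  set V : Submodule ℝ (Y → ℝ) := Submodule.span ℝ (B : Set (Y → ℝ)) with hV
  have hone : (1 : Y → ℝ) ∈ V := Submodule.subset_span (by
    simp only [hB, Finset.coe_image, Finset.coe_univ, Set.image_univ]; exact ⟨none, rfl⟩)
  have hcoord (l : Fin d) : (fun i => x i l) ∈ V := Submodule.subset_span (by
    simp only [hB, Finset.coe_image, Finset.coe_univ, Set.image_univ]; exact ⟨some l, rfl⟩)
  have hrank : Module.finrank ℝ ↥(V ^ S.card) < Module.finrank ℝ (Y → ℝ) := by
    rw [Module.finrank_fintype_fun_eq_card, hV, Submodule.span_pow, ← Finset.coe_pow]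
    calc _ ≤ (B ^ S.card).card := finrank_span_finset_le_card _
      _ ≤ B.card ^ S.card := Finset.card_pow_le
      _ ≤ (d + 1) ^ S.card := by
        gcongr
        exact Finset.card_image_le.trans (by simp)
      _ < _ := hlt
  obtain ⟨f, hf0, hf⟩ := Submodule.exists_le_ker_of_lt_top (V ^ S.card)
    (lt_top_iff_ne_top.2 fun htop => by rw [htop, finrank_top] at hrank; exact hrank.false)
  have hsq : (fun i => ‖x i‖ ^ 2) ∈ V ^ 2 := by
    have : (fun i => ‖x i‖ ^ 2) = ∑ l, (fun i => x i l) * fun i => x i l := by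
      funext i
      simp [EuclideanSpace.real_norm_sq_eq, ← sq]
    rw [this, pow_two]
    exact Submodule.sum_mem _ fun l _ => Submodule.mul_mem_mul (hcoord l) (hcoord l)
  have hone0 : (1 : Y → ℝ) ∈ V ^ 0 := by rw [pow_zero]; exact Submodule.one_le.1 le_rfl
  have hfactor (c : ℝ) : (fun i j => c - dist (x i) (x j) ^ 2) ∈ separatedSpan V 2 := by
    have h1 : (fun i j => (1 : Y → ℝ) i * ‖x j‖ ^ 2) ∈ separatedSpan V 2 :=
      Submodule.subset_span ⟨0, 2, rfl, _, hone0, _, hsq, rfl⟩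
    have h2 : (fun i j => ‖x i‖ ^ 2 * (1 : Y → ℝ) j) ∈ separatedSpan V 2 :=
      Submodule.subset_span ⟨2, 0, rfl, _, hsq, _, hone0, rfl⟩
    have h3 : (fun i j => (1 : Y → ℝ) i * (1 : Y → ℝ) j) ∈ separatedSpan V 2 :=
      Submodule.subset_span ⟨0, 2, rfl, _, hone0, _,
        Submodule.one_le.1 (one_le_pow₀ (Submodule.one_le.2 hone)), rfl⟩
    have h4 : ∑ l, (fun i j => x i l * x j l) ∈ separatedSpan V 2 :=
      Submodule.sum_mem _ fun l _ => Submodule.subset_span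
        ⟨1, 1, rfl, _, by rw [pow_one]; exact hcoord l, _, by rw [pow_one]; exact hcoord l, rfl⟩
    convert Submodule.sub_mem _ (Submodule.add_mem _ (Submodule.smul_mem _ c h3)
      (Submodule.smul_mem _ 2 h4)) (Submodule.add_mem _ h1 h2) using 1
    funext i j
    have : inner ℝ (x i) (x j) = ∑ l, x i l * x j l := by
      simp [PiLp.inner_apply, mul_comm]
    simp [dist_eq_norm, norm_sub_sq_real, this, Finset.sum_apply]
    ring
  set F : Y → Y → ℝ := ∏ p ∈ S, fun i j => τ p ^ 2 - dist (x i) (x j) ^ 2 with hF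
  have hFmem : F ∈ separatedSpan V (2 * S.card) :=
    prod_mem_separatedSpan V S _ 2 fun p _ => hfactor _
  have hFeq (i : Y) : F i = (∏ p ∈ S, τ p ^ 2) • Pi.single i (1 : ℝ) := by
    funext j
    simp only [hF, Finset.prod_apply, Pi.smul_apply, smul_eq_mul]
    rcases eq_or_ne j i with rfl | hij
    · simp
    · obtain ⟨p, hp, hd⟩ := h i j hij.symm
      rw [Pi.single_eq_of_ne hij, mul_zero]
      exact Finset.prod_eq_zero hp (by rw [hd, sub_self])
  have hzero := apply_apply_eq_zero_of_mem_separatedSpan hone (fun u hu => hf hu) hFmem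
  set g : Y → ℝ := fun i => f (Pi.single i (1 : ℝ)) with hg
  have hfg (u : Y → ℝ) : f u = ∑ i, u i * g i := by
    rw [LinearMap.pi_apply_eq_sum_univ f u]
    refine Finset.sum_congr rfl fun i _ => ?_
    rw [smul_eq_mul, hg]
    congr 2
    funext j
    simp [Pi.single_apply, eq_comm]
  have hc : ∏ p ∈ S, τ p ^ 2 ≠ 0 := Finset.prod_ne_zero_iff.2 fun p hp => pow_ne_zero _ (hτ p hp)
  have hsum : ∑ i, g i * g i = 0 := by
    simp only [hFeq, map_smul] at hzero
    rw [hfg] at hzero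
    simp only [smul_eq_mul, mul_assoc, ← Finset.mul_sum] at hzero
    exact (mul_eq_zero.1 hzero).resolve_left hc
  have hg0 (i : Y) : g i = 0 := mul_self_eq_zero.1
    ((Finset.sum_eq_zero_iff_of_nonneg fun i _ => mul_self_nonneg (g i)).1 hsum i
      (Finset.mem_univ i))
  exact hf0 (LinearMap.ext fun u => by simp [hfg, hg0])

theorem Ultrafilter.exists_tendsto_of_isCompact {α X : Type*} [TopologicalSpace X]
    (F : Ultrafilter α) {K : Set X} (hK : IsCompact K) {u : α → X} (hu : ∀ᶠ m in F, u m ∈ K) :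
    ∃ a ∈ K, Tendsto u F (𝓝 a) :=
  hK.ultrafilter_le_nhds' (F.map u) hu

/-- If along an ultrafilter every distance between two of the points indexed by `A` is asymptotic to
one of the scales `t p` with `p ∈ S`, then `A` has at most `(d + 1) ^ #S` elements. -/
theorem card_le_of_tendsto_dist_div {α ι I : Type*} {d : ℕ} (F : Ultrafilter α) (t : ι → α → ℝ)
    (ht : ∀ p m, 0 < t p m) (x : I → α → EuclideanSpace ℝ (Fin d)) (S : Finset ι) :
    ∀ A : Finset I, (∀ i ∈ A, ∀ j ∈ A, i ≠ j →
      ∃ p ∈ S, Tendsto (fun m => dist (x i m) (x j m) / t p m) F (𝓝 1)) →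
      A.card ≤ (d + 1) ^ S.card := by
  induction S using Finset.strongInduction with
  | H S ih =>
  intro A hA
  rcases S.eq_empty_or_nonempty with rfl | hS
  · simp only [Finset.card_empty, pow_zero]
    refine Finset.card_le_one.2 fun i hi j hj => ?_
    by_contra hij
    simpa using hA i hi j hj hij
  rcases A.eq_empty_or_nonempty with rfl | ⟨a, ha⟩
  · simp
  obtain ⟨p₀, hp₀, hmax⟩ : ∃ p ∈ S, ∀ᶠ m in F, ∀ q ∈ S, t q m ≤ t p m := by
    refine (Ultrafilter.eventually_exists_mem_iff S.finite_toSet).1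
      (Eventually.of_forall fun m => ?_)
    exact S.exists_max_image (fun p => t p m) hS
  have hscale (p : ι) : ∃ τ, p ∈ S → Tendsto (fun m => t p m / t p₀ m) F (𝓝 τ) := by
    by_cases hp : p ∈ S
    · obtain ⟨τ, -, hτ⟩ := F.exists_tendsto_of_isCompact (isCompact_Icc (a := (0 : ℝ)) (b := 1))
        (u := fun m => t p m / t p₀ m) (hmax.mono fun m hm =>
          ⟨(div_pos (ht p m) (ht p₀ m)).le, (div_le_one (ht p₀ m)).2 (hm p hp)⟩)
      exact ⟨τ, fun _ => hτ⟩
    · exact ⟨0, fun h => absurd h hp⟩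
  choose τ hτ using hscale
  have hτ₀ : τ p₀ = 1 := by
    refine tendsto_nhds_unique (hτ p₀ hp₀) ?_
    simp only [div_self (ht p₀ _).ne', tendsto_const_nhds]
  have hdist (i j : I) (p : ι) (hp : p ∈ S)
      (h : Tendsto (fun m => dist (x i m) (x j m) / t p m) F (𝓝 1)) :
      Tendsto (fun m => dist (x i m) (x j m) / t p₀ m) F (𝓝 (τ p)) := by
    have := h.mul (hτ p hp)
    rw [one_mul] at this
    refine this.congr fun m => ?_
    rw [div_mul_div_cancel₀ (ht p m).ne']
  set u : I → α → EuclideanSpace ℝ (Fin d) := fun i m => (t p₀ m)⁻¹ • (x i m - x a m) with hu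
  have hu_dist (i j : I) (m : α) : dist (u i m) (u j m) = dist (x i m) (x j m) / t p₀ m := by
    rw [hu, dist_smul₀, dist_sub_right, Real.norm_of_nonneg (inv_pos.2 (ht p₀ m)).le,
      inv_mul_eq_div]
  have hlim (i : I) : ∃ y, i ∈ A → Tendsto (u i) F (𝓝 y) := by
    by_cases hi : i ∈ A
    · have hbdd : ∃ R : ℝ, ∀ᶠ m in F, u i m ∈ Metric.closedBall 0 R := by
        have hua (m : α) : u a m = 0 := by simp [hu]
        rcases eq_or_ne i a with rfl | hia
        · exact ⟨0, Eventually.of_forall fun m => by simp [hua]⟩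
        · obtain ⟨p, hp, h⟩ := hA i hi a ha hia
          refine ⟨τ p + 1, ((hdist i a p hp h).eventually_le_const (lt_add_one _)).mono
            fun m hm => ?_⟩
          rwa [Metric.mem_closedBall, ← hua m, hu_dist]
      obtain ⟨R, hR⟩ := hbdd
      obtain ⟨y, -, hy⟩ := F.exists_tendsto_of_isCompact (isCompact_closedBall _ R) hR
      exact ⟨y, fun _ => hy⟩
    · exact ⟨0, fun h => absurd h hi⟩
  choose y hy using hlim
  have hy_dist (i j : I) (hi : i ∈ A) (hj : j ∈ A) (p : ι) (hp : p ∈ S)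
      (h : Tendsto (fun m => dist (x i m) (x j m) / t p m) F (𝓝 1)) : dist (y i) (y j) = τ p := by
    refine tendsto_nhds_unique ((hy i hi).dist (hy j hj)) ?_
    simpa only [hu_dist] using hdist i j p hp h
  have himage : (A.image y).card ≤ (d + 1) ^ (S.filter (τ · ≠ 0)).card := by
    rw [← Fintype.card_coe]
    refine card_le_of_dist_mem (fun z : A.image y => (z : EuclideanSpace ℝ (Fin d))) _ τ
      (fun p hp => (Finset.mem_filter.1 hp).2) ?_
    rintro ⟨z, hz⟩ ⟨w, hw⟩ hzw
    obtain ⟨i, hi, rfl⟩ := Finset.mem_image.1 hz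
    obtain ⟨j, hj, rfl⟩ := Finset.mem_image.1 hw
    have hne : y i ≠ y j := fun h => hzw (Subtype.ext h)
    obtain ⟨p, hp, h⟩ := hA i hi j hj fun hij => hne (congrArg y hij)
    have hd := hy_dist i j hi hj p hp h
    exact ⟨p, Finset.mem_filter.2 ⟨hp, hd ▸ dist_ne_zero.2 hne⟩, hd⟩
  have hfiber (z) (_ : z ∈ A.image y) :
      (A.filter (y · = z)).card ≤ (d + 1) ^ (S.filter (¬ τ · ≠ 0)).card := by
    refine ih _ (Finset.filter_ssubset.2 ⟨p₀, hp₀, by simp [hτ₀]⟩) _ fun i hi j hj hij => ?_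
    rw [Finset.mem_filter] at hi hj
    obtain ⟨p, hp, h⟩ := hA i hi.1 j hj.1 hij
    have hd := hy_dist i j hi.1 hj.1 p hp h
    rw [hi.2, hj.2, dist_self] at hd
    exact ⟨p, Finset.mem_filter.2 ⟨hp, by simp [← hd]⟩, h⟩
  calc A.card ≤ (d + 1) ^ (S.filter (¬ τ · ≠ 0)).card * (A.image y).card :=
        Finset.card_le_mul_card_image A _ hfiber
    _ ≤ (d + 1) ^ (S.filter (¬ τ · ≠ 0)).card * (d + 1) ^ (S.filter (τ · ≠ 0)).card := by gcongr
    _ = (d + 1) ^ S.card := by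
      rw [← pow_add, add_comm (Finset.card _), Finset.card_filter_add_card_filter_not]

/-- If `ε` is small enough, no `(d + 1) ^ k + 1` points of `ℝᵈ` have all their distances
in `k` intervals of the form `[t, (1 + ε) t]`. -/
theorem exists_forall_not_dist_mem_Icc (d k : ℕ) :
    ∃ ε₀ : ℝ, 0 < ε₀ ∧ ∀ ε : ℝ, 0 < ε → ε < ε₀ →
      ∀ (x : Fin ((d + 1) ^ k + 1) → EuclideanSpace ℝ (Fin d)) (t : Fin k → ℝ), (∀ p, 0 < t p) →
        ¬ ∀ i j, i ≠ j → ∃ p, dist (x i) (x j) ∈ Set.Icc (t p) (t p + ε * t p) := by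
  by_contra! hcon
  choose ε hε hε' x t ht h using fun m : ℕ => hcon (1 / ((m : ℝ) + 1)) Nat.one_div_pos_of_nat
  have hF : ((hyperfilter ℕ : Ultrafilter ℕ) : Filter ℕ) ≤ atTop := by
    rw [← Nat.cofinite_eq_atTop]; exact hyperfilter_le_cofinite
  have hε0 : Tendsto (fun m => 1 + ε m) (hyperfilter ℕ : Ultrafilter ℕ) (𝓝 1) := by
    have := (squeeze_zero (fun m => (hε m).le) (fun m => (hε' m).le)
      tendsto_one_div_add_atTop_nhds_zero_nat).const_add 1
    rw [add_zero] at this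
    exact this.mono_left hF
  have hcard := card_le_of_tendsto_dist_div (hyperfilter ℕ) (fun p m => t m p)
    (fun p m => ht m p) (fun i m => x m i) Finset.univ Finset.univ fun i _ j _ hij => by
      obtain ⟨p, hp⟩ := Ultrafilter.eventually_exists_iff.1
        (Eventually.of_forall (f := (hyperfilter ℕ : Ultrafilter ℕ)) fun m => h m i j hij)
      refine ⟨p, Finset.mem_univ p, tendsto_of_tendsto_of_tendsto_of_le_of_le'
        tendsto_const_nhds hε0 (hp.mono fun m hm => ?_) (hp.mono fun m hm => ?_)⟩
      · exact (one_le_div (ht m p)).2 hm.1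
      · rw [div_le_iff₀ (ht m p), add_mul, one_mul]
        exact hm.2
  simp at hcard

theorem card_edgeFinset_le_turanNum {n r : ℕ} (hr : 0 < r) {G : SimpleGraph (Fin n)}
    (hG : G.CliqueFree (r + 1)) : G.edgeFinset.card ≤ turanNum n (r + 1) := by
  have := (SimpleGraph.isTuranMaximal_turanGraph (n := n) hr).2 hG
  rw [turanNum, Nat.add_sub_cancel]
  convert this

theorem count_pairs_in_k_additive_intervals_le_turan
    (d k : ℕ) (hd : 1 ≤ d) (hk : 1 ≤ k) :
    ∃ ε₀ : ℝ, 0 < ε₀ ∧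
      ∀ ε : ℝ, 0 < ε → ε < ε₀ →
        ∀ (n : ℕ), 1 ≤ n →
          ∀ (P : Fin n → EuclideanSpace ℝ (Fin d)) (t : Fin k → ℝ),
            (∀ p, 0 < t p) →
            (Finset.univ.filter fun q : Fin n × Fin n => q.1 < q.2 ∧
                ∃ p, dist (P q.1) (P q.2) ∈
                  Set.Icc (t p) (t p + ε * ⨅ r, t r)).card
              ≤ turanNum n ((d + 1) ^ k + 1) := by
  obtain ⟨ε₀, hε₀, h⟩ := exists_forall_not_dist_mem_Icc d k
  refine ⟨ε₀, hε₀, fun ε hε hlt n _ P t ht => ?_⟩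
  let G : SimpleGraph (Fin n) :=
    { Adj := fun i j => i ≠ j ∧ ∃ p, dist (P i) (P j) ∈ Set.Icc (t p) (t p + ε * ⨅ r, t r)
      symm := ⟨fun i j hij => by rwa [ne_comm, dist_comm]⟩
      loopless := ⟨fun i hi => hi.1 rfl⟩ }
  have hG : G.CliqueFree ((d + 1) ^ k + 1) := by
    by_contra hcl
    let e := SimpleGraph.topEmbeddingOfNotCliqueFree hcl
    refine h ε hε hlt (P ∘ e) t ht fun i j hij => ?_
    obtain ⟨-, p, hp⟩ : G.Adj (e i) (e j) := e.map_adj_iff.2 hij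
    refine ⟨p, hp.1, hp.2.trans ?_⟩
    gcongr
    exact ciInf_le (Set.finite_range t).bddBelow p
  refine le_trans ?_ (card_edgeFinset_le_turanNum (by positivity) hG)
  refine Finset.card_le_card_of_injOn (fun q => s(q.1, q.2)) (fun q hq => ?_) ?_
  · obtain ⟨hq, hp⟩ := (Finset.mem_filter.1 hq).2
    simpa [G] using ⟨hq.ne, hp⟩
  · rintro ⟨a, b⟩ hab ⟨a', b'⟩ hab' heq
    have h1 := (Finset.mem_filter.1 hab).2.1
    have h2 := (Finset.mem_filter.1 hab').2.1
    rcases Sym2.eq_iff.1 heq with ⟨h3, h4⟩ | ⟨h3, h4⟩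
    · exact Prod.ext h3 h4
    · simp only at h1 h2 h3 h4
      subst h3 h4
      exact absurd h1 h2.asymm
end
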